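/- Let m ≥ 2, let L be a number field with ring of integers 𝓞_L, let f be a nonzero integer, and let 𝓞_{L,f} = 𝓞_L[1/f] be the localization of 𝓞_L away from f. Let Γ be a finitely generated subgroup of SL_m(𝓞_{L,f}). Then Γ is residually finite, and for every finite generating set Y of Γ one has F_{Γ,Y}(n) ≼ n^{m²−1}; moreover the detecting quotients can be taken of the form SL_m(𝔽_p). (Proposition 4.2 instantiated at G = SL_m, with dim SL_m = m²−1.) -/

import Mathlib

open scoped Pointwise

section FarbDefs

variable {G : Type*} [Group G]

/-- Word length of `g` with respect to a generating set `X` (symmetrized). -/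
noncomputable def wordLength (X : Set G) (g : G) : ℕ :=
  sInf {n | ∃ l : List G, l.length = n ∧ (∀ x ∈ l, x ∈ X ∨ x⁻¹ ∈ X) ∧ l.prod = g}

/-- `farbD g` is the minimal cardinality of a finite quotient of `G` detecting `g`. -/
noncomputable def farbD (g : G) : ℕ :=
  sInf {k | ∃ N : Subgroup G, N.Normal ∧ N.FiniteIndex ∧ g ∉ N ∧ N.index = k}

/-- The normal Farb growth function of `G` with respect to `X`. -/
noncomputable def farbF (X : Set G) (n : ℕ) : ℕ :=
  sSup {d | ∃ g : G, g ≠ 1 ∧ wordLength X g ≤ n ∧ farbD g = d}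

/-- The auxiliary function `F^k`. -/
noncomputable def farbFk (k : ℕ) (X : Set G) (n : ℕ) : ℕ :=
  sSup {d | ∃ g : G, g ^ k ≠ 1 ∧ wordLength X g ≤ n ∧ farbD (g ^ k) = d}

/-- `f ≼ g` : there is `M` with `f n ≤ M * g (M * n)` for all `n`. -/
def FarbPreceq (f g : ℕ → ℕ) : Prop := ∃ M : ℕ, 0 < M ∧ ∀ n, f n ≤ M * g (M * n)

/-- `f ≈ g`. -/
def FarbEquiv (f g : ℕ → ℕ) : Prop := FarbPreceq f g ∧ FarbPreceq g f

/-- A group is residually finite if every nontrivial element is detected by a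
finite quotient. -/
def ResiduallyFinite (G : Type*) [Group G] : Prop :=
  ∀ g : G, g ≠ 1 → ∃ N : Subgroup G, N.Normal ∧ N.FiniteIndex ∧ g ∉ N

end FarbDefs


open NumberField

section Coordinates

/-- All coordinates of `x` in the integral basis of `L` are at most `A` in absolute value. -/
def CoordLE {L : Type*} [Field L] [NumberField L] (x : L) (A : ℝ) : Prop :=
  ∀ i, |(((integralBasis L).repr x i : ℚ) : ℝ)| ≤ A

variable {L : Type*} [Field L] [NumberField L]

theorem CoordLE.mono {x : L} {A B : ℝ} (h : CoordLE x A) (hAB : A ≤ B) : CoordLE x B :=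
  fun i => (h i).trans hAB

theorem CoordLE.add {x y : L} {A B : ℝ} (hx : CoordLE x A) (hy : CoordLE y B) :
    CoordLE (x + y) (A + B) := fun i => by
  simp only [map_add, Finsupp.add_apply, Rat.cast_add]
  exact (abs_add_le _ _).trans (add_le_add (hx i) (hy i))

theorem CoordLE.neg {x : L} {A : ℝ} (hx : CoordLE x A) : CoordLE (-x) A := fun i => by
  simpa using hx i

theorem CoordLE.sub {x y : L} {A B : ℝ} (hx : CoordLE x A) (hy : CoordLE y B) :
    CoordLE (x - y) (A + B) := by
  rw [sub_eq_add_neg]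
  exact hx.add hy.neg

theorem CoordLE.sum {κ : Type*} (s : Finset κ) {f : κ → L} {A : κ → ℝ}
    (h : ∀ j ∈ s, CoordLE (f j) (A j)) : CoordLE (∑ j ∈ s, f j) (∑ j ∈ s, A j) := fun i => by
  simp only [map_sum, Finsupp.finsetSum_apply, Rat.cast_sum]
  exact (Finset.abs_sum_le_sum_abs _ _).trans (Finset.sum_le_sum fun j hj => h j hj i)

theorem exists_coordLE (x : L) : ∃ A : ℕ, CoordLE x A := by
  obtain ⟨A, hA⟩ := exists_nat_ge (∑ i, |(((integralBasis L).repr x i : ℚ) : ℝ)|)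
  exact ⟨A, fun i => (Finset.single_le_sum (f := fun i => |(((integralBasis L).repr x i : ℚ) : ℝ)|)
    (fun j _ => abs_nonneg _) (Finset.mem_univ i)).trans hA⟩

theorem exists_coordLE_of_finite {κ : Type*} [Finite κ] (f : κ → L) :
    ∃ A : ℕ, 1 ≤ A ∧ ∀ k, CoordLE (f k) A := by
  cases nonempty_fintype κ
  choose A hA using fun k => exists_coordLE (f k)
  refine ⟨∑ k, A k + 1, by omega, fun k => (hA k).mono ?_⟩
  have := Finset.single_le_sum (f := A) (fun j _ => Nat.zero_le _) (Finset.mem_univ k)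
  exact_mod_cast this.trans (Nat.le_succ _)

theorem CoordLE.smul {x : L} {A B : ℝ} (r : ℚ) (hx : CoordLE x A) (hr : |(r : ℝ)| ≤ B) :
    CoordLE (r • x) (B * A) := fun i => by
  simp only [map_smul, Finsupp.smul_apply, smul_eq_mul, Rat.cast_mul, abs_mul]
  exact mul_le_mul hr (hx i) (abs_nonneg _) ((abs_nonneg _).trans hr)

theorem CoordLE.nonneg {x : L} {A : ℝ} (hx : CoordLE x A) : 0 ≤ A := by
  obtain ⟨i⟩ := (integralBasis L).index_nonempty
  exact (abs_nonneg _).trans (hx i)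

variable (L)

theorem exists_coordLE_mul : ∃ C : ℕ, 1 ≤ C ∧ ∀ (x y : L) (A B : ℝ), CoordLE x A → CoordLE y B →
    CoordLE (x * y) (C * A * B) := by
  obtain ⟨C, hC, h⟩ := exists_coordLE_of_finite
    (fun k : Module.Free.ChooseBasisIndex ℤ (𝓞 L) × Module.Free.ChooseBasisIndex ℤ (𝓞 L) =>
      integralBasis L k.1 * integralBasis L k.2)
  set e := Fintype.card (Module.Free.ChooseBasisIndex ℤ (𝓞 L)) with he
  have he0 : 1 ≤ e := Fintype.card_pos_iff.mpr (integralBasis L).index_nonempty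
  refine ⟨e * e * C, Nat.one_le_iff_ne_zero.mpr (by positivity), fun x y A B hx hy => ?_⟩
  have hxy : x * y = ∑ i, ∑ j, (((integralBasis L).repr x i) * ((integralBasis L).repr y j)) •
      (integralBasis L i * integralBasis L j) := by
    conv_lhs => rw [← (integralBasis L).sum_repr x, ← (integralBasis L).sum_repr y]
    rw [Finset.sum_mul_sum]
    simp only [smul_mul_smul_comm]
  rw [hxy]
  have := CoordLE.sum Finset.univ (fun i _ => CoordLE.sum Finset.univ (fun j _ =>
    (h (i, j)).smul ((((integralBasis L).repr x i) * ((integralBasis L).repr y j))) (B := A * B) (by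
      rw [Rat.cast_mul, abs_mul]
      exact mul_le_mul (hx i) (hy j) (abs_nonneg _) hx.nonneg)))
  refine this.mono (le_of_eq ?_)
  simp only [Finset.sum_const, Finset.card_univ, ← he, nsmul_eq_mul]
  push_cast
  ring

theorem exists_norm_embedding_le : ∃ K : ℕ, 1 ≤ K ∧ ∀ (σ : L →ₐ[ℚ] ℂ) (x : L) (A : ℝ),
    CoordLE x A → ‖σ x‖ ≤ K * A := by
  obtain ⟨K, hK⟩ := exists_nat_ge (∑ σ : L →ₐ[ℚ] ℂ, ∑ i, ‖σ (integralBasis L i)‖)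
  refine ⟨K + 1, by omega, fun σ x A hx => ?_⟩
  have h1 : ‖σ x‖ ≤ A * ∑ i, ‖σ (integralBasis L i)‖ := by
    conv_lhs => rw [← (integralBasis L).sum_repr x]
    rw [map_sum, Finset.mul_sum]
    refine (norm_sum_le _ _).trans (Finset.sum_le_sum fun i _ => ?_)
    rw [Algebra.smul_def, map_mul, AlgHom.commutes, eq_ratCast, norm_mul]
    refine mul_le_mul_of_nonneg_right ?_ (norm_nonneg _)
    rw [← Complex.ofReal_ratCast, Complex.norm_real]
    exact hx i
  have h2 := Finset.single_le_sum (f := fun σ : L →ₐ[ℚ] ℂ => ∑ i, ‖σ (integralBasis L i)‖)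
    (fun _ _ => Finset.sum_nonneg fun _ _ => norm_nonneg _) (Finset.mem_univ σ)
  have h3 := hx.nonneg
  calc ‖σ x‖ ≤ _ := h1
    _ ≤ A * (K + 1) := mul_le_mul_of_nonneg_left (by linarith) h3
    _ = _ := by push_cast; ring

variable {L}

theorem absNorm_span_eq_prod (a : 𝓞 L) :
    ((Ideal.absNorm (Ideal.span {a}) : ℕ) : ℝ) = ∏ σ : L →ₐ[ℚ] ℂ, ‖σ (a : L)‖ := by
  rw [Ideal.absNorm_span_singleton, ← norm_prod, ← Algebra.norm_eq_prod_embeddings,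
    ← Algebra.coe_norm_int, Nat.cast_natAbs]
  simp

/-- The integers of `L` all of whose coordinates are at most `N` in absolute value. -/
noncomputable def coordBox (L : Type*) [Field L] [NumberField L] (N : ℕ) : Finset (𝓞 L) :=
  (Fintype.piFinset fun _ => Finset.Icc (-N : ℤ) N).map
    (RingOfIntegers.basis L).equivFun.symm.toEquiv.toEmbedding

theorem mem_coordBox {N : ℕ} {a : 𝓞 L} : a ∈ coordBox L N ↔ CoordLE (a : L) N := by
  have h : ∀ i, (((integralBasis L).repr (a : L) i : ℚ) : ℝ) =
      (((RingOfIntegers.basis L).repr a i : ℤ) : ℝ) := fun i => by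
    have := integralBasis_repr_apply L a i
    rw [this]; simp
  simp only [coordBox, CoordLE, h, Finset.mem_map_equiv, Fintype.mem_piFinset, Finset.mem_Icc]
  refine forall_congr' fun i => ?_
  rw [← Int.cast_abs, show (N : ℝ) = ((N : ℤ) : ℝ) by simp, Int.cast_le, abs_le]
  rfl

theorem card_coordBox (N : ℕ) : (coordBox L N).card = (2 * N + 1) ^ Module.finrank ℚ L := by
  rw [coordBox, Finset.card_map, Fintype.card_piFinset]
  simp only [Int.card_Icc, Finset.prod_const, Finset.card_univ]
  rw [← Module.finrank_eq_card_basis (RingOfIntegers.basis L), RingOfIntegers.rank]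
  congr 1
  omega

theorem exists_small_mem (I : Ideal (𝓞 L)) (t : ℕ) (hI : Ideal.absNorm I ≠ 0)
    (ht : Ideal.absNorm I < (t + 1) ^ Module.finrank ℚ L) :
    ∃ a ∈ I, a ≠ 0 ∧ CoordLE (a : L) t := by
  classical
  have := (Ideal.absNorm_ne_zero_iff I).mp hI
  cases nonempty_fintype (𝓞 L ⧸ I)
  let b := RingOfIntegers.basis L
  let g : (Module.Free.ChooseBasisIndex ℤ (𝓞 L) → Fin (t + 1)) → 𝓞 L :=
    fun v => b.equivFun.symm fun i => ((v i : ℕ) : ℤ)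
  have hcard : Fintype.card (𝓞 L ⧸ I) <
      Fintype.card (Module.Free.ChooseBasisIndex ℤ (𝓞 L) → Fin (t + 1)) := by
    rw [Fintype.card_fun, Fintype.card_fin, ← Module.finrank_eq_card_basis b, RingOfIntegers.rank,
      ← Nat.card_eq_fintype_card]
    exact ht
  obtain ⟨v, w, hvw, h⟩ := Fintype.exists_ne_map_eq_of_card_lt
    (fun v => Ideal.Quotient.mk I (g v)) hcard
  refine ⟨g v - g w, Ideal.Quotient.eq.mp h, fun h0 => hvw ?_, fun i => ?_⟩
  · have := b.equivFun.symm.injective (sub_eq_zero.mp h0)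
    ext i
    have := congrFun this i
    simpa using this
  · have h1 := integralBasis_repr_apply L (g v - g w) i
    have h2 : (RingOfIntegers.basis L).repr (g v - g w) i = ((v i : ℕ) : ℤ) - ((w i : ℕ) : ℤ) := by
      rw [map_sub]
      have h3 : ∀ v, (RingOfIntegers.basis L).repr (g v) i = ((v i : ℕ) : ℤ) := fun v => by
        change b.equivFun (b.equivFun.symm _) i = _
        rw [LinearEquiv.apply_symm_apply]
      rw [Finsupp.sub_apply, h3, h3]
    change |(((integralBasis L).repr (algebraMap (𝓞 L) L (g v - g w)) i : ℚ) : ℝ)| ≤ t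
    rw [h1, h2]
    have hv := (v i).2
    have hw := (w i).2
    have : |((v i : ℕ) : ℤ) - ((w i : ℕ) : ℤ)| ≤ t := by rw [abs_le]; omega
    have h4 : |((((v i : ℕ) : ℤ) - ((w i : ℕ) : ℤ) : ℤ) : ℝ)| ≤ t := by exact_mod_cast this
    simpa using h4

variable (L)

theorem exists_small_representative : ∃ C : ℕ, 1 ≤ C ∧ ∀ (I : Ideal (𝓞 L)) (t : ℕ),
    Ideal.absNorm I ≠ 0 → Ideal.absNorm I < (t + 1) ^ Module.finrank ℚ L →
    ∀ β : 𝓞 L, ∃ r : 𝓞 L, β - r ∈ I ∧ CoordLE (r : L) ((C * t : ℕ) : ℝ) := by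
  obtain ⟨C, hC, h⟩ := exists_coordLE_mul L
  refine ⟨C, hC, fun I t hI ht β => ?_⟩
  obtain ⟨a, haI, ha0, ha⟩ := exists_small_mem I t hI ht
  have ha0' : (a : L) ≠ 0 := by simpa using ha0
  set y := (integralBasis L).repr ((β : L) / a) with hy
  set s : 𝓞 L := ∑ i, ⌊y i⌋ • RingOfIntegers.basis L i with hs
  refine ⟨β - a * s, by simpa using I.mul_mem_right s haI, ?_⟩
  have hs' : (s : L) = ∑ i, ((⌊y i⌋ : ℤ) : ℚ) • integralBasis L i := by
    rw [hs]
    refine (map_sum (algebraMap (𝓞 L) L) _ _).trans ?_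
    refine Finset.sum_congr rfl fun i _ => ?_
    rw [map_zsmul, integralBasis_apply, Int.cast_smul_eq_zsmul]
  have hfr : CoordLE ((β : L) / a - s) 1 := by
    intro i
    have : (integralBasis L).repr ((β : L) / a - s) i = Int.fract (y i) := by
      rw [map_sub, hs', Finsupp.sub_apply, Module.Basis.repr_sum_self, ← hy]
      rfl
    rw [this, abs_le]
    constructor
    · have := Int.fract_nonneg (y i)
      have : (0 : ℝ) ≤ (Int.fract (y i) : ℚ) := by exact_mod_cast this
      linarith
    · exact_mod_cast (Int.fract_lt_one (y i)).le
  have := h _ _ _ _ ha hfr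
  have heq : ((β - a * s : 𝓞 L) : L) = (a : L) * ((β : L) / a - s) := by
    rw [mul_sub, mul_div_cancel₀ _ ha0']
    simp
  rw [heq]
  exact this.mono (le_of_eq (by push_cast; ring))

end Coordinates

section LatticeCount

theorem one_add_pow_le_one_add_mul {x h : ℝ} (hx : 0 ≤ x) (hxh : x ≤ h) (n : ℕ) :
    (1 + x) ^ n ≤ 1 + x * (n * (1 + h) ^ n) := by
  induction n with
  | zero => simp
  | succ n ih =>
    have h1 : (1 + x) ^ n ≤ (1 + h) ^ n := by gcongr
    have h2 : (1 + h) ^ n ≤ (1 + h) ^ (n + 1) := pow_le_pow_right₀ (by linarith) (by omega)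
    have h3 : x * (n * (1 + h) ^ n) ≤ x * (n * (1 + h) ^ (n + 1)) := by gcongr
    calc (1 + x) ^ (n + 1) = (1 + x) ^ n + x * (1 + x) ^ n := by ring
      _ ≤ (1 + x * (n * (1 + h) ^ n)) + x * (1 + h) ^ (n + 1) := by gcongr; exact h1.trans h2
      _ ≤ _ := by push_cast; linarith

variable {L : Type*} [Field L] [NumberField L]

open Classical in
/-- The number of elements of the ideal `I` in the box of radius `N` centred at `c`. -/
noncomputable def boxCount (c : 𝓞 L) (N : ℕ) (I : Ideal (𝓞 L)) : ℕ :=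
  ((coordBox L N).filter fun β => c + β ∈ I).card

open Classical in
theorem boxCount_mul_le {I : Ideal (𝓞 L)} (hI : Ideal.absNorm I ≠ 0) {δ : ℕ}
    (h : ∀ β : 𝓞 L, ∃ r : 𝓞 L, β - r ∈ I ∧ CoordLE (r : L) δ) (c : 𝓞 L) (N : ℕ) :
    boxCount c N I * Ideal.absNorm I ≤ (2 * (N + δ) + 1) ^ Module.finrank ℚ L := by
  have := (Ideal.absNorm_ne_zero_iff I).mp hI
  cases nonempty_fintype (𝓞 L ⧸ I)
  choose r hr hrδ using h
  have hq : Ideal.absNorm I = (Finset.univ : Finset (𝓞 L ⧸ I)).card := by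
    rw [Finset.card_univ, ← Nat.card_eq_fintype_card]; rfl
  rw [← card_coordBox, boxCount, hq, ← Finset.card_product]
  refine Finset.card_le_card_of_injOn (fun z => z.1 + r z.2.out) ?_ ?_
  · rintro ⟨x, y⟩ hxy
    simp only [Finset.coe_product, Finset.coe_univ, Set.mem_prod, Finset.coe_filter,
      Set.mem_ofPred_eq, mem_coordBox] at hxy
    simp only [SetLike.mem_coe, mem_coordBox]
    have := hxy.1.1.add (hrδ y.out)
    simpa using this
  · rintro ⟨x, y⟩ hxy ⟨x', y'⟩ hxy' heq
    simp only [Finset.coe_product, Finset.coe_univ, Set.mem_prod, Finset.coe_filter,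
      Set.mem_ofPred_eq] at hxy hxy' heq
    have h1 : x - x' ∈ I := by
      have := I.sub_mem hxy.1.2 hxy'.1.2
      simpa using this
    have h2 : r y.out - r y'.out ∈ I := by
      have : r y.out - r y'.out = -(x - x') := by linear_combination heq
      rw [this]
      exact I.neg_mem h1
    have h3 : y.out - y'.out ∈ I := by
      have := I.add_mem (I.sub_mem (hr y.out) (hr y'.out)) h2
      convert this using 1
      ring
    have h4 : y = y' := by
      rw [← Ideal.Quotient.mk_out y, ← Ideal.Quotient.mk_out y']
      exact Ideal.Quotient.eq.mpr h3
    subst h4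
    simpa using heq

open Classical in
theorem le_mul_boxCount {I : Ideal (𝓞 L)} (hI : Ideal.absNorm I ≠ 0) {δ : ℕ}
    (h : ∀ β : 𝓞 L, ∃ r : 𝓞 L, β - r ∈ I ∧ CoordLE (r : L) δ) (c : 𝓞 L) {N : ℕ} (hN : δ ≤ N) :
    (2 * (N - δ) + 1) ^ Module.finrank ℚ L ≤ Ideal.absNorm I * boxCount c N I := by
  have := (Ideal.absNorm_ne_zero_iff I).mp hI
  cases nonempty_fintype (𝓞 L ⧸ I)
  choose r hr hrδ using h
  have hq : Ideal.absNorm I = (Finset.univ : Finset (𝓞 L ⧸ I)).card := by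
    rw [Finset.card_univ, ← Nat.card_eq_fintype_card]; rfl
  rw [← card_coordBox, boxCount, hq, ← Finset.card_product]
  have hout : ∀ β : 𝓞 L, β - (Ideal.Quotient.mk I β).out ∈ I := fun β =>
    Ideal.Quotient.eq.mp (by rw [Ideal.Quotient.mk_out])
  refine Finset.card_le_card_of_injOn
    (fun β => (Ideal.Quotient.mk I (c + β), β - r (Ideal.Quotient.mk I (c + β)).out)) ?_ ?_
  · intro β hβ
    simp only [SetLike.mem_coe, mem_coordBox] at hβ
    simp only [Finset.coe_product, Finset.coe_univ, Set.mem_prod, Finset.coe_filter,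
      Set.mem_ofPred_eq, Set.mem_univ, true_and, mem_coordBox]
    constructor
    · have := hβ.sub (hrδ (Ideal.Quotient.mk I (c + β)).out)
      rw [Nat.cast_sub hN] at this
      simpa using this
    · have := I.add_mem (hout (c + β)) (hr (Ideal.Quotient.mk I (c + β)).out)
      convert this using 1
      ring
  · intro β _ β' _ heq
    simp only [Prod.mk.injEq] at heq
    have h2 := heq.2
    rw [heq.1] at h2
    simpa using h2

variable (L)

theorem exists_boxCount_bounds (h : ℝ) : ∃ D : ℝ, 0 ≤ D ∧ ∀ (c : 𝓞 L) (N : ℕ) (I : Ideal (𝓞 L)),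
    1 ≤ N → Ideal.absNorm I ≠ 0 →
    ((2 * N + 1 : ℕ) : ℝ) ^ Module.finrank ℚ L *
        (1 - D * (Ideal.absNorm I : ℝ) ^ (1 / (Module.finrank ℚ L : ℝ)) / N) ≤
      Ideal.absNorm I * boxCount c N I ∧
    ((Ideal.absNorm I : ℝ) ^ (1 / (Module.finrank ℚ L : ℝ)) ≤ h * N →
      Ideal.absNorm I * boxCount c N I ≤ ((2 * N + 1 : ℕ) : ℝ) ^ Module.finrank ℚ L *
        (1 + D * (Ideal.absNorm I : ℝ) ^ (1 / (Module.finrank ℚ L : ℝ)) / N)) := by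
  obtain ⟨C, hC, hrep⟩ := exists_small_representative L
  set d := Module.finrank ℚ L with hd
  have hd0 : 0 < d := Module.finrank_pos
  have hC0 : (1 : ℝ) ≤ C := by exact_mod_cast hC
  have hd1 : (1 : ℝ) ≤ d := by exact_mod_cast hd0
  refine ⟨C * (d * (1 + C * |h|) ^ d), by positivity, fun c N I hN hI => ?_⟩
  set q := Ideal.absNorm I with hq
  set s : ℝ := (q : ℝ) ^ (1 / (d : ℝ)) with hs
  have hs0 : 0 ≤ s := by positivity
  have hsd : s ^ d = q := by
    rw [hs, one_div, Real.rpow_inv_natCast_pow (by positivity) hd0.ne']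
  set t := ⌊s⌋₊ with ht
  have hts : (t : ℝ) ≤ s := Nat.floor_le hs0
  have hlt : q < (t + 1) ^ d := by
    have h1 : s < t + 1 := Nat.lt_floor_add_one s
    have h2 : s ^ d < ((t : ℝ) + 1) ^ d := pow_lt_pow_left₀ h1 hs0 hd0.ne'
    rw [hsd] at h2
    exact_mod_cast h2
  have hr := hrep I t hI hlt
  have hN0 : (1 : ℝ) ≤ N := by exact_mod_cast hN
  have hW : (0 : ℝ) < ((2 * N + 1 : ℕ) : ℝ) ^ d := by positivity
  have hpow1 : 1 ≤ (1 + C * |h|) ^ d := one_le_pow₀ (by nlinarith [abs_nonneg h])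
  constructor
  · have hD : (d : ℝ) * (2 * (C * t : ℕ) / (2 * N + 1 : ℕ)) ≤
        C * (d * (1 + C * |h|) ^ d) * s / N := by
      calc (d : ℝ) * (2 * (C * t : ℕ) / (2 * N + 1 : ℕ)) ≤ d * (2 * (C * t) / (2 * N)) := by
            push_cast; gcongr; linarith
        _ = C * (d * 1) * t / N := by field_simp
        _ ≤ _ := by gcongr
    by_cases hδ : C * t ≤ N
    · have h1 := le_mul_boxCount hI hr c hδ
      rw [← hd, ← hq] at h1
      have h2 : ((2 * (N - C * t) + 1 : ℕ) : ℝ) =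
          (2 * N + 1 : ℕ) * (1 + -(2 * (C * t : ℕ) / (2 * N + 1 : ℕ))) := by
        push_cast [Nat.cast_sub hδ]
        field_simp
        ring
      have h3 : (((2 * (N - C * t) + 1 : ℕ) : ℝ)) ^ d ≤ q * boxCount c N I := by exact_mod_cast h1
      rw [h2, mul_pow] at h3
      refine le_trans ?_ h3
      refine mul_le_mul_of_nonneg_left ?_ hW.le
      have h4 : (2 * (C * t : ℕ) / (2 * N + 1 : ℕ) : ℝ) ≤ 2 := by
        rw [div_le_iff₀ (by positivity)]
        have : ((C * t : ℕ) : ℝ) ≤ N := by exact_mod_cast hδ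
        push_cast at this ⊢
        linarith
      have := one_add_mul_le_pow (a := -(2 * (C * t : ℕ) / (2 * N + 1 : ℕ) : ℝ)) (by linarith) d
      linarith
    · have h5 : (1 : ℝ) ≤ 2 * (C * t : ℕ) / (2 * N + 1 : ℕ) := by
        rw [le_div_iff₀ (by positivity)]
        have : ((N + 1 : ℕ) : ℝ) ≤ (C * t : ℕ) := by exact_mod_cast Nat.lt_of_not_le hδ
        push_cast at this ⊢
        linarith
      have h6 : (1 : ℝ) ≤ C * (d * (1 + C * |h|) ^ d) * s / N := by
        refine le_trans ?_ hD
        nlinarith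
      refine le_trans (mul_nonpos_of_nonneg_of_nonpos hW.le (by linarith)) (by positivity)
  · intro hsh
    have h1 := boxCount_mul_le hI hr c N
    rw [← hd, ← hq] at h1
    have h2 : ((2 * (N + C * t) + 1 : ℕ) : ℝ) ≤ (2 * N + 1 : ℕ) * (1 + C * s / N) := by
      have : ((2 * N + 1 : ℕ) : ℝ) * (1 + C * s / N) = 2 * N + 1 + 2 * (C * s) + C * s / N := by
        push_cast
        field_simp
        ring
      rw [this]
      have h3 : (C : ℝ) * t ≤ C * s := by gcongr
      have h4 : 0 ≤ C * s / N := by positivity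
      push_cast
      linarith
    have h3 : (q : ℝ) * boxCount c N I ≤ (((2 * (N + C * t) + 1 : ℕ) : ℝ)) ^ d := by
      rw [mul_comm]
      exact_mod_cast h1
    refine h3.trans ((pow_le_pow_left₀ (by positivity) h2 d).trans ?_)
    rw [mul_pow]
    refine mul_le_mul_of_nonneg_left ?_ hW.le
    have h4 : C * s / N ≤ C * |h| := by
      rw [div_le_iff₀ (by positivity)]
      have : h * N ≤ |h| * N := by gcongr; exact le_abs_self h
      calc C * s ≤ C * (|h| * N) := by gcongr; linarith
        _ = _ := by ring
    refine (one_add_pow_le_one_add_mul (by positivity) h4 d).trans (le_of_eq ?_)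
    ring

end LatticeCount

section WeightedChebyshev

theorem sum_mul_le_of_partial_sums_le {a w : ℕ → ℝ} {c : ℝ} (hw : Antitone w) (hw0 : ∀ n, 0 ≤ w n)
    (ha : ∀ n, ∑ i ∈ Finset.range n, a i ≤ c * n) (n : ℕ) :
    ∑ i ∈ Finset.range n, a i * w i ≤ c * ∑ i ∈ Finset.range n, w i := by
  have key : ∀ n, (c * n - ∑ i ∈ Finset.range n, a i) * w n ≤
      c * ∑ i ∈ Finset.range n, w i - ∑ i ∈ Finset.range n, a i * w i := by
    intro n
    induction n with
    | zero => simp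
    | succ n ih =>
      refine (mul_le_mul_of_nonneg_left (hw n.le_succ) (sub_nonneg.mpr (ha (n + 1)))).trans ?_
      rw [Finset.sum_range_succ, Finset.sum_range_succ, Finset.sum_range_succ]
      push_cast
      linarith
  have := mul_nonneg (sub_nonneg.mpr (ha n)) (hw0 n)
  linarith [key n]

theorem sum_primesLE_eq (X : ℕ) (g : ℕ → ℝ) :
    ∑ p ∈ Nat.primesLE X, g p =
      ∑ i ∈ Finset.range X, if (i + 1).Prime then g (i + 1) else 0 := by
  rw [Nat.primesLE, Nat.primesBelow, Finset.sum_filter, Finset.sum_range_succ']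
  simp [Nat.not_prime_zero]

theorem sum_primesLE_log_mul_le {w : ℕ → ℝ} (hw : Antitone fun i => w (i + 1))
    (hw0 : ∀ n, 0 ≤ w (n + 1)) (X : ℕ) :
    ∑ p ∈ Nat.primesLE X, Real.log p * w p ≤
      Real.log 4 * ∑ i ∈ Finset.range X, w (i + 1) := by
  rw [sum_primesLE_eq X fun p => Real.log p * w p]
  have := sum_mul_le_of_partial_sums_le
    (a := fun i => if (i + 1).Prime then Real.log (i + 1 : ℕ) else 0)
    (w := fun i => w (i + 1)) (c := Real.log 4) hw hw0 (fun n => by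
      rw [← sum_primesLE_eq n fun p => Real.log p, ← Chebyshev.theta_eq_sum_primesLE_log]
      exact Chebyshev.theta_le_log4_mul_x (by positivity)) X
  simpa only [ite_mul, zero_mul] using this

theorem sum_primesLE_log_div_sq_le (X : ℕ) :
    ∑ p ∈ Nat.primesLE X, Real.log p / (p : ℝ) ^ 2 ≤ Real.log 4 * 2 := by
  have h1 := sum_primesLE_log_mul_le (w := fun m => ((m : ℝ) ^ 2)⁻¹)
    (fun i j hij => by
      simp only
      gcongr) (fun n => by positivity) X
  simp only [← div_eq_mul_inv] at h1
  refine h1.trans (mul_le_mul_of_nonneg_left ?_ (Real.log_nonneg (by norm_num)))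
  rcases Nat.eq_zero_or_pos X with rfl | hX
  · simp
  have h2 : ∀ n : ℕ, ∑ i ∈ Finset.range (n + 1), (((i + 1 : ℕ) : ℝ) ^ 2)⁻¹ ≤ 2 - 1 / (n + 1) := by
    intro n
    induction n with
    | zero => norm_num
    | succ n ih =>
      rw [Finset.sum_range_succ]
      have : (((n + 1 + 1 : ℕ) : ℝ) ^ 2)⁻¹ ≤ 1 / (n + 1) - 1 / (n + 1 + 1) := by
        push_cast
        rw [div_sub_div _ _ (by positivity) (by positivity), inv_eq_one_div,
          div_le_div_iff₀ (by positivity) (by positivity)]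
        nlinarith
      push_cast at *
      linarith
  obtain ⟨n, rfl⟩ : ∃ n, X = n + 1 := ⟨X - 1, by omega⟩
  have h3 : 0 ≤ 1 / ((n : ℝ) + 1) := by positivity
  linarith [h2 n]

theorem sum_range_rpow_le {s : ℝ} (hs0 : 0 < s) (hs1 : s ≤ 1) (n : ℕ) :
    ∑ i ∈ Finset.range n, ((i + 1 : ℕ) : ℝ) ^ (s - 1) ≤ s⁻¹ * (n : ℝ) ^ s := by
  induction n with
  | zero => simp [Real.zero_rpow hs0.ne']
  | succ n ih =>
    rw [Finset.sum_range_succ]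
    have hy : (0 : ℝ) < (n + 1 : ℕ) := by positivity
    have h1 : (-1 : ℝ) ≤ -1 / (n + 1 : ℕ) := by
      rw [neg_div, neg_le_neg_iff, div_le_one hy]
      simp
    have h2 := rpow_one_add_le_one_add_mul_self h1 hs0.le hs1
    have h3 : (n : ℝ) ^ s = ((n + 1 : ℕ) : ℝ) ^ s * (1 + -1 / (n + 1 : ℕ)) ^ s := by
      rw [← Real.mul_rpow hy.le (by linarith)]
      congr 1
      push_cast
      field_simp
      ring
    have h4 : ((n + 1 : ℕ) : ℝ) ^ (s - 1) = ((n + 1 : ℕ) : ℝ) ^ s * (1 / (n + 1 : ℕ)) := by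
      rw [Real.rpow_sub_one hy.ne']
      ring
    have h5 : 0 ≤ ((n + 1 : ℕ) : ℝ) ^ s := by positivity
    have h6 : (n : ℝ) ^ s ≤ ((n + 1 : ℕ) : ℝ) ^ s * (1 + s * (-1 / (n + 1 : ℕ))) := by
      rw [h3]
      exact mul_le_mul_of_nonneg_left h2 h5
    rw [h4]
    have h7 : s⁻¹ * (n : ℝ) ^ s ≤
        s⁻¹ * (((n + 1 : ℕ) : ℝ) ^ s * (1 + s * (-1 / (n + 1 : ℕ)))) := by gcongr
    have h8 : s⁻¹ * (((n + 1 : ℕ) : ℝ) ^ s * (1 + s * (-1 / (n + 1 : ℕ)))) =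
        s⁻¹ * ((n + 1 : ℕ) : ℝ) ^ s - ((n + 1 : ℕ) : ℝ) ^ s * (1 / (n + 1 : ℕ)) := by
      field_simp
      ring
    linarith

theorem sum_primesLE_log_mul_rpow_le {s : ℝ} (hs0 : 0 < s) (hs1 : s ≤ 1) (X : ℕ) :
    ∑ p ∈ Nat.primesLE X, Real.log p * (p : ℝ) ^ (s - 1) ≤
      Real.log 4 * s⁻¹ * (X : ℝ) ^ s := by
  refine (sum_primesLE_log_mul_le (w := fun m => (m : ℝ) ^ (s - 1)) (fun i j hij => ?_)
    (fun n => by positivity) X).trans ?_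
  · exact Real.rpow_le_rpow_of_nonpos (by positivity) (by exact_mod_cast Nat.succ_le_succ hij)
      (by linarith)
  · rw [mul_assoc]
    exact mul_le_mul_of_nonneg_left (sum_range_rpow_le hs0 hs1 X)
      (Real.log_nonneg (by norm_num))

end WeightedChebyshev

section PrimeIdeals

variable {L : Type*} [Field L] [NumberField L]

theorem exists_absNorm_eq_pow {P : Ideal (𝓞 L)} (hP : Prime P) :
    ∃ p f : ℕ, p.Prime ∧ 1 ≤ f ∧ Ideal.absNorm P = p ^ f ∧ (p : 𝓞 L) ∈ P := by
  have hPp : P.IsPrime := Ideal.isPrime_of_prime hP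
  have hmax : P.IsMaximal := hPp.isMaximal hP.ne_zero
  have hfin : Finite (𝓞 L ⧸ P) := Ideal.finiteQuotientOfFreeOfNeBot P hP.ne_zero
  let := Ideal.Quotient.field P
  cases nonempty_fintype (𝓞 L ⧸ P)
  obtain ⟨p, _, n, hp, hn⟩ := FiniteField.card' (𝓞 L ⧸ P)
  have h : Ideal.absNorm P = p ^ (n : ℕ) := by
    rw [← hn, ← Nat.card_eq_fintype_card]; rfl
  refine ⟨p, n, hp, n.2, h, ?_⟩
  have := Ideal.absNorm_mem P
  rw [h, Nat.cast_pow] at this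
  exact hPp.mem_of_pow_mem _ this

theorem two_le_absNorm {P : Ideal (𝓞 L)} (hP : Prime P) : 2 ≤ Ideal.absNorm P := by
  obtain ⟨p, f, hp, hf, h, -⟩ := exists_absNorm_eq_pow hP
  rw [h]
  exact hp.two_le.trans (Nat.le_self_pow (by omega) p)

theorem prod_absNorm_dvd {S : Finset (Ideal (𝓞 L))} (hS : ∀ P ∈ S, Prime P) {a : 𝓞 L}
    (ha : ∀ P ∈ S, a ∈ P) :
    ∏ P ∈ S, Ideal.absNorm P ∣ Ideal.absNorm (Ideal.span {a}) := by
  rw [← map_prod]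
  refine map_dvd Ideal.absNorm (Finset.prod_primes_dvd _ hS fun P hP => ?_)
  exact Ideal.dvd_span_singleton.mpr (ha P hP)

theorem sum_log_absNorm_le {S : Finset (Ideal (𝓞 L))} (hS : ∀ P ∈ S, Prime P) {a : 𝓞 L}
    (ha0 : a ≠ 0) (ha : ∀ P ∈ S, a ∈ P) :
    ∑ P ∈ S, Real.log (Ideal.absNorm P) ≤ Real.log (Ideal.absNorm (Ideal.span {a})) := by
  rw [← Real.log_prod fun P hP => by
    have := two_le_absNorm (hS P hP)
    positivity]
  have h0 : 0 < Ideal.absNorm (Ideal.span {a}) := by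
    rw [Nat.pos_iff_ne_zero, ne_eq, Ideal.absNorm_eq_zero_iff]
    simpa using ha0
  refine Real.log_le_log (Finset.prod_pos fun P hP => by
    have := two_le_absNorm (hS P hP)
    positivity) ?_
  exact_mod_cast Nat.le_of_dvd h0 (prod_absNorm_dvd hS ha)

theorem absNorm_span_natCast (p : ℕ) :
    Ideal.absNorm (Ideal.span {(p : 𝓞 L)}) = p ^ Module.finrank ℚ L := by
  rw [Ideal.absNorm_span_singleton, ← map_natCast (algebraMap ℤ (𝓞 L)), Algebra.norm_algebraMap,
    RingOfIntegers.rank]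
  simp [Int.natAbs_pow]

open Classical in
/-- The nonzero prime ideals of norm at most `X`. -/
noncomputable def primeIdealsLE (L : Type*) [Field L] [NumberField L] (X : ℕ) :
    Finset (Ideal (𝓞 L)) :=
  (Ideal.finite_setOfPred_absNorm_le (S := 𝓞 L) X).toFinset.filter Prime

theorem mem_primeIdealsLE {X : ℕ} {P : Ideal (𝓞 L)} :
    P ∈ primeIdealsLE L X ↔ Ideal.absNorm P ≤ X ∧ Prime P := by
  simp [primeIdealsLE]

/-- The prime ideals of residue degree one and norm at most `X`. -/
noncomputable def degreeOneLE (L : Type*) [Field L] [NumberField L] (X : ℕ) :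
    Finset (Ideal (𝓞 L)) :=
  (primeIdealsLE L X).filter fun P => (Ideal.absNorm P).Prime

theorem mem_degreeOneLE {X : ℕ} {P : Ideal (𝓞 L)} :
    P ∈ degreeOneLE L X ↔ Ideal.absNorm P ≤ X ∧ Prime P ∧ (Ideal.absNorm P).Prime := by
  simp [degreeOneLE, mem_primeIdealsLE, and_assoc]

open Classical in
theorem sum_minFac_absNorm_le {g : ℕ → ℝ} (hg : ∀ p : ℕ, 0 ≤ g p) (X : ℕ) :
    ∑ P ∈ primeIdealsLE L X, g (Ideal.absNorm P).minFac ≤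
      Module.finrank ℚ L * ∑ p ∈ Nat.primesLE X, g p := by
  have hmaps : ∀ P ∈ primeIdealsLE L X, (Ideal.absNorm P).minFac ∈ Nat.primesLE X := by
    intro P hP
    rw [mem_primeIdealsLE] at hP
    have := two_le_absNorm hP.2
    exact Nat.mem_primesLE.mpr ⟨(Nat.minFac_le (by omega)).trans hP.1,
      Nat.minFac_prime (by omega)⟩
  rw [← Finset.sum_fiberwise_of_maps_to hmaps, Finset.mul_sum]
  refine Finset.sum_le_sum fun p hp => ?_
  have hpp := Nat.prime_of_mem_primesLE hp
  rw [Finset.sum_congr rfl (g := fun _ => g p) fun P hP => by rw [(Finset.mem_filter.mp hP).2],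
    Finset.sum_const, nsmul_eq_mul]
  refine mul_le_mul_of_nonneg_right ?_ (hg p)
  have hmem : ∀ P ∈ (primeIdealsLE L X).filter fun P => (Ideal.absNorm P).minFac = p,
      Prime P ∧ (p : 𝓞 L) ∈ P ∧ p ≤ Ideal.absNorm P := by
    intro P hP
    obtain ⟨hP1, hP2⟩ := Finset.mem_filter.mp hP
    have hPr := (mem_primeIdealsLE.mp hP1).2
    obtain ⟨p', f, hp', hf, h, hm⟩ := exists_absNorm_eq_pow hPr
    rw [h, Nat.pow_minFac (by omega), hp'.minFac_eq] at hP2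
    subst hP2
    exact ⟨hPr, hm, h ▸ Nat.le_self_pow (by omega) _⟩
  have h1 := prod_absNorm_dvd (fun P hP => (hmem P hP).1) (fun P hP => (hmem P hP).2.1)
  rw [absNorm_span_natCast] at h1
  have h2 := Nat.le_of_dvd (pow_pos hpp.pos _) h1
  have h3 : p ^ ((primeIdealsLE L X).filter fun P => (Ideal.absNorm P).minFac = p).card ≤
      p ^ Module.finrank ℚ L := by
    rw [← Finset.prod_const]
    exact (Finset.prod_le_prod' fun P hP => (hmem P hP).2.2).trans h2
  exact_mod_cast (Nat.pow_le_pow_iff_right hpp.one_lt).mp h3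

theorem log_absNorm_le_finrank_mul {P : Ideal (𝓞 L)} (hP : Prime P) :
    Real.log (Ideal.absNorm P) ≤
      Module.finrank ℚ L * Real.log (Ideal.absNorm P).minFac := by
  obtain ⟨p, f, hp, hf, h, hm⟩ := exists_absNorm_eq_pow hP
  have h1 := prod_absNorm_dvd (S := {P}) (by simpa using hP) (by simpa using hm)
  rw [absNorm_span_natCast, Finset.prod_singleton, h] at h1
  have h2 := (Nat.pow_dvd_pow_iff_le_right hp.one_lt).mp h1
  rw [h, Nat.pow_minFac (by omega), hp.minFac_eq]
  push_cast
  rw [Real.log_pow]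
  have := Real.log_natCast_nonneg p
  gcongr

open Classical UniqueFactorizationMonoid in
theorem log_absNorm_span_le {a : 𝓞 L} (ha : a ≠ 0) {X k : ℕ}
    (hX : Ideal.absNorm (Ideal.span {a}) ≤ X) (hk : Ideal.absNorm (Ideal.span {a}) < 2 ^ (k + 1)) :
    Real.log (Ideal.absNorm (Ideal.span {a})) ≤ ∑ P ∈ primeIdealsLE L X,
      Real.log (Ideal.absNorm P) * ∑ j ∈ Finset.Icc 1 k, if a ∈ P ^ j then 1 else 0 := by
  set J := Ideal.span {a} with hJ
  have hJ0 : J ≠ 0 := by simpa [hJ] using ha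
  have hNJ : 0 < Ideal.absNorm J := by
    rw [Nat.pos_iff_ne_zero, ne_eq, Ideal.absNorm_eq_zero_iff]
    exact hJ0
  have hfac : Ideal.absNorm J = ∏ P ∈ (normalizedFactors J).toFinset,
      Ideal.absNorm P ^ (normalizedFactors J).count P := by
    conv_lhs => rw [← associated_iff_eq.mp (prod_normalizedFactors hJ0),
      Finset.prod_multiset_count]
    simp
  have hprime : ∀ P ∈ (normalizedFactors J).toFinset, Prime P := fun P hP =>
    prime_of_normalized_factor P (Multiset.mem_toFinset.mp hP)
  have hdvd : ∀ P j, j ≤ (normalizedFactors J).count P →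
      P ∈ (normalizedFactors J).toFinset → P ^ j ∣ J := by
    intro P j hj hP
    rw [pow_dvd_iff_le_emultiplicity, emultiplicity_eq_count_normalizedFactors
      (hprime P hP).irreducible hJ0, normalize_eq]
    exact_mod_cast hj
  rw [hfac]
  push_cast
  rw [Real.log_prod fun P hP => by
    have := two_le_absNorm (hprime P hP)
    positivity]
  have hsub : (normalizedFactors J).toFinset ⊆ primeIdealsLE L X := fun P hP => by
    refine mem_primeIdealsLE.mpr ⟨(Nat.le_of_dvd hNJ (map_dvd Ideal.absNorm ?_)).trans hX,
      hprime P hP⟩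
    exact dvd_of_mem_normalizedFactors (Multiset.mem_toFinset.mp hP)
  refine le_trans (Finset.sum_le_sum fun P hP => ?_)
    (Finset.sum_le_sum_of_subset_of_nonneg hsub fun P hP _ => mul_nonneg
      (Real.log_natCast_nonneg _) (Finset.sum_nonneg fun j _ => by split_ifs <;> norm_num))
  rw [Real.log_pow, mul_comm]
  refine mul_le_mul_of_nonneg_left ?_ (Real.log_natCast_nonneg _)
  have hck : (normalizedFactors J).count P ≤ k := by
    have h1 := Nat.le_of_dvd hNJ (map_dvd Ideal.absNorm (hdvd P _ le_rfl hP))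
    rw [map_pow] at h1
    have h2 := Nat.pow_le_pow_left (two_le_absNorm (hprime P hP)) ((normalizedFactors J).count P)
    have := (Nat.pow_lt_pow_iff_right (by norm_num : 1 < 2)).mp ((h2.trans h1).trans_lt hk)
    omega
  have : ∑ j ∈ Finset.Icc 1 ((normalizedFactors J).count P), (if a ∈ P ^ j then (1 : ℝ) else 0) =
      (normalizedFactors J).count P := by
    rw [Finset.sum_congr rfl (g := fun _ => (1 : ℝ)) fun j hj => by
      rw [if_pos (Ideal.dvd_span_singleton.mp (hdvd P j (Finset.mem_Icc.mp hj).2 hP))]]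
    simp
  rw [← this]
  exact Finset.sum_le_sum_of_subset_of_nonneg (Finset.Icc_subset_Icc_right hck)
    fun j _ _ => by split_ifs <;> norm_num

end PrimeIdeals

section Mertens

variable (L : Type*) [Field L] [NumberField L]

theorem sum_degreeOneLE_log_mul_rpow_le (X : ℕ) :
    ∑ P ∈ degreeOneLE L X, Real.log (Ideal.absNorm P) *
        (Ideal.absNorm P : ℝ) ^ (1 / (Module.finrank ℚ L : ℝ) - 1) ≤
      Module.finrank ℚ L * (Real.log 4 * Module.finrank ℚ L *
        (X : ℝ) ^ (1 / (Module.finrank ℚ L : ℝ))) := by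
  have hd : 0 < Module.finrank ℚ L := Module.finrank_pos
  have hd1 : (1 : ℝ) ≤ Module.finrank ℚ L := by exact_mod_cast hd
  set s : ℝ := 1 / (Module.finrank ℚ L : ℝ) with hs
  have hs0 : 0 < s := by positivity
  have hs1 : s ≤ 1 := by rw [hs, div_le_one (by positivity)]; exact hd1
  have hsum := sum_primesLE_log_mul_rpow_le hs0 hs1 X
  have hinv : s⁻¹ = Module.finrank ℚ L := by rw [hs, one_div, inv_inv]
  rw [hinv] at hsum
  have hg : ∀ p : ℕ, 0 ≤ Real.log p * (p : ℝ) ^ (s - 1) := fun p =>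
    mul_nonneg (Real.log_natCast_nonneg p) (by positivity)
  refine le_trans ?_ ((sum_minFac_absNorm_le (L := L) hg X).trans
    (mul_le_mul_of_nonneg_left hsum (by positivity)))
  refine le_trans (le_of_eq (Finset.sum_congr rfl fun P hP => ?_))
    (Finset.sum_le_sum_of_subset_of_nonneg (Finset.filter_subset _ _) fun P _ _ => hg _)
  rw [(mem_degreeOneLE.mp hP).2.2.minFac_eq]

theorem exists_center : ∃ H : ℕ, 1 ≤ H ∧ ∀ N : ℕ, 1 ≤ N → ∃ c : 𝓞 L, ∀ β ∈ coordBox L N,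
    N ^ Module.finrank ℚ L ≤ Ideal.absNorm (Ideal.span {c + β}) ∧
    Ideal.absNorm (Ideal.span {c + β}) ≤ (H * N) ^ Module.finrank ℚ L := by
  obtain ⟨K, hK, h⟩ := exists_norm_embedding_le L
  refine ⟨2 * K + 1, by omega, fun N hN => ⟨(((K + 1) * N : ℕ) : 𝓞 L), fun β hβ => ?_⟩⟩
  have hcard : Fintype.card (L →ₐ[ℚ] ℂ) = Module.finrank ℚ L := AlgHom.card ℚ L ℂ
  have hσ : ∀ σ : L →ₐ[ℚ] ℂ, (N : ℝ) ≤ ‖σ (((((K + 1) * N : ℕ) : 𝓞 L) + β : 𝓞 L) : L)‖ ∧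
      ‖σ (((((K + 1) * N : ℕ) : 𝓞 L) + β : 𝓞 L) : L)‖ ≤ ((2 * K + 1) * N : ℕ) := by
    intro σ
    have h1 := h σ _ _ (mem_coordBox.mp hβ)
    have h2 : σ (((((K + 1) * N : ℕ) : 𝓞 L) + β : 𝓞 L) : L) =
        (((K + 1) * N : ℕ) : ℂ) + σ (β : L) := by
      simp
    have h3 : ‖(((K + 1) * N : ℕ) : ℂ)‖ = ((K + 1) * N : ℕ) := Complex.norm_natCast _
    rw [h2]
    have h4 := norm_add_le (((K + 1) * N : ℕ) : ℂ) (σ (β : L))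
    have h5 := norm_sub_le_norm_add (((K + 1) * N : ℕ) : ℂ) (σ (β : L))
    rw [h3] at h4 h5
    push_cast at *
    constructor <;> linarith
  constructor
  · have : ((N ^ Module.finrank ℚ L : ℕ) : ℝ) ≤
        Ideal.absNorm (Ideal.span {((((K + 1) * N : ℕ) : 𝓞 L) + β : 𝓞 L)}) := by
      rw [absNorm_span_eq_prod, ← hcard, ← Finset.card_univ, Nat.cast_pow, ← Finset.prod_const]
      exact Finset.prod_le_prod (fun _ _ => by positivity) fun σ _ => (hσ σ).1
    exact_mod_cast this
  · have : ((Ideal.absNorm (Ideal.span {((((K + 1) * N : ℕ) : 𝓞 L) + β : 𝓞 L)}) : ℕ) : ℝ) ≤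
        (((2 * K + 1) * N) ^ Module.finrank ℚ L : ℕ) := by
      rw [absNorm_span_eq_prod, ← hcard, ← Finset.card_univ, Nat.cast_pow, ← Finset.prod_const]
      exact Finset.prod_le_prod (fun _ _ => by positivity) fun σ _ => (hσ σ).2
    exact_mod_cast this

variable {L}

theorem natCast_pow_rpow_one_div {d : ℕ} (hd : 0 < d) (N : ℕ) :
    ((N ^ d : ℕ) : ℝ) ^ (1 / (d : ℝ)) = N := by
  rw [Nat.cast_pow, one_div, Real.pow_rpow_inv_natCast (by positivity) hd.ne']

open Classical in
theorem sum_boxCount (c : 𝓞 L) (N : ℕ) {κ : Type*} (S : Finset κ) (u : κ → ℝ)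
    (I : κ → Ideal (𝓞 L)) :
    ∑ P ∈ S, u P * boxCount c N (I P) =
      ∑ β ∈ coordBox L N, ∑ P ∈ S, u P * if c + β ∈ I P then 1 else 0 := by
  rw [Finset.sum_comm]
  refine Finset.sum_congr rfl fun P _ => ?_
  rw [← Finset.mul_sum, boxCount, Finset.card_filter]
  push_cast
  rfl

variable (L)

open Classical in
theorem exists_mertens_le : ∃ C : ℝ, ∀ N : ℕ, 1 ≤ N →
    ∑ P ∈ degreeOneLE L (N ^ Module.finrank ℚ L), Real.log (Ideal.absNorm P) / Ideal.absNorm P ≤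
      Module.finrank ℚ L * Real.log N + C := by
  obtain ⟨H, hH, hcen⟩ := exists_center L
  obtain ⟨D, hD, hbox⟩ := exists_boxCount_bounds L 0
  have hE := sum_degreeOneLE_log_mul_rpow_le L
  set d := Module.finrank ℚ L with hd
  have hd0 : 0 < d := Module.finrank_pos
  refine ⟨d * Real.log H + D * (d * (Real.log 4 * d)), fun N hN => ?_⟩
  obtain ⟨c, hc⟩ := hcen N hN
  have hN0 : (0 : ℝ) < N := by exact_mod_cast hN
  set W : ℝ := ((2 * N + 1 : ℕ) : ℝ) ^ d with hWdef
  have hW : 0 < W := by positivity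
  have hWcard : W = (coordBox L N).card := by rw [card_coordBox]; push_cast [hWdef]; rfl
  have h1 : ∑ P ∈ degreeOneLE L (N ^ d), Real.log (Ideal.absNorm P) * boxCount c N P ≤
      W * (d * (Real.log H + Real.log N)) := by
    rw [sum_boxCount, hWcard, ← nsmul_eq_mul, ← Finset.sum_const]
    refine Finset.sum_le_sum fun β hβ => ?_
    obtain ⟨hl, hu⟩ := hc β hβ
    have hpos : 0 < Ideal.absNorm (Ideal.span {c + β}) := lt_of_lt_of_le (by positivity) hl
    have hne : c + β ≠ 0 := by
      rintro h0
      rw [h0] at hpos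
      simp at hpos
    simp only [mul_ite, mul_one, mul_zero]
    rw [← Finset.sum_filter]
    refine (sum_log_absNorm_le (fun P hP => ?_) hne fun P hP => (Finset.mem_filter.mp hP).2).trans ?_
    · exact (mem_degreeOneLE.mp (Finset.mem_filter.mp hP).1).2.1
    · refine (Real.log_le_log (by exact_mod_cast hpos) (Nat.cast_le.mpr hu)).trans (le_of_eq ?_)
      push_cast
      rw [Real.log_pow, Real.log_mul (by positivity) (by positivity)]
  have h2 : W * (∑ P ∈ degreeOneLE L (N ^ d), Real.log (Ideal.absNorm P) / Ideal.absNorm P -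
      D / N * ∑ P ∈ degreeOneLE L (N ^ d), Real.log (Ideal.absNorm P) *
        (Ideal.absNorm P : ℝ) ^ (1 / (d : ℝ) - 1)) ≤
      ∑ P ∈ degreeOneLE L (N ^ d), Real.log (Ideal.absNorm P) * boxCount c N P := by
    rw [Finset.mul_sum, ← Finset.sum_sub_distrib, Finset.mul_sum]
    refine Finset.sum_le_sum fun P hP => ?_
    obtain ⟨-, hPp, hPq⟩ := mem_degreeOneLE.mp hP
    have hq : (0 : ℝ) < Ideal.absNorm P := by exact_mod_cast hPq.pos
    have h3 := (hbox c N P hN hPq.ne_zero).1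
    have h4 := mul_le_mul_of_nonneg_left h3
      (div_nonneg (Real.log_natCast_nonneg (Ideal.absNorm P)) hq.le)
    rw [Real.rpow_sub_one hq.ne']
    convert h4 using 1
    · rw [← hWdef]
      field_simp
    · field_simp
  have h5 := le_of_mul_le_mul_left (h2.trans h1) hW
  have h6 := hE (N ^ d)
  rw [natCast_pow_rpow_one_div hd0] at h6
  have h7 := mul_le_mul_of_nonneg_left h6 (div_nonneg hD hN0.le)
  have h8 : D / N * (d * (Real.log 4 * d * N)) = D * (d * (Real.log 4 * d)) := by
    field_simp
  linarith

theorem sum_Ico_inv_pow_le {q : ℕ} (hq : 2 ≤ q) (m n : ℕ) :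
    ∑ j ∈ Finset.Ico m n, (((q ^ j : ℕ) : ℝ))⁻¹ ≤ 2 * ((q : ℝ) ^ m)⁻¹ := by
  have hq' : (2 : ℝ) ≤ q := by exact_mod_cast hq
  have h := geom_sum_Ico_le_of_lt_one (x := ((q : ℝ))⁻¹) (m := m) (n := n) (by positivity)
    (inv_lt_one_of_one_lt₀ (by linarith))
  simp only [Nat.cast_pow, ← inv_pow]
  refine h.trans ?_
  rw [div_le_iff₀ (sub_pos.mpr (inv_lt_one_of_one_lt₀ (by linarith)))]
  have h2 : ((q : ℝ))⁻¹ ≤ 2⁻¹ := inv_anti₀ (by norm_num) hq'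
  have h3 : 0 ≤ ((q : ℝ))⁻¹ ^ m := by positivity
  nlinarith

open Classical in
theorem exists_le_mertens : ∃ H : ℕ, 1 ≤ H ∧ ∃ C : ℝ, ∀ N : ℕ, 1 ≤ N →
    Module.finrank ℚ L * Real.log N ≤
    ∑ P ∈ degreeOneLE L ((H * N) ^ Module.finrank ℚ L),
      Real.log (Ideal.absNorm P) / Ideal.absNorm P + C := by
  obtain ⟨H, hH, hcen⟩ := exists_center L
  obtain ⟨D, hD, hbox⟩ := exists_boxCount_bounds L H
  have hE := sum_degreeOneLE_log_mul_rpow_le L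
  set d := Module.finrank ℚ L with hd
  have hd0 : 0 < d := Module.finrank_pos
  have hd1 : (1 : ℝ) ≤ d := by exact_mod_cast hd0
  set B : ℝ := 1 + D * H with hB
  have hB0 : 0 ≤ B := by positivity
  refine ⟨H, hH, D * (d * (Real.log 4 * d * H)) + 2 * d * B * (d * (Real.log 4 * 2)),
    fun N hN => ?_⟩
  obtain ⟨c, hc⟩ := hcen N hN
  have hN0 : (0 : ℝ) < N := by exact_mod_cast hN
  set W : ℝ := ((2 * N + 1 : ℕ) : ℝ) ^ d with hWdef
  have hW : 0 < W := by positivity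
  have hWcard : W = (coordBox L N).card := by rw [card_coordBox]; push_cast [hWdef]; rfl
  set X := (H * N) ^ d with hX
  have hX1 : 1 ≤ X := Nat.one_le_pow _ _ (by positivity)
  have hXroot : (X : ℝ) ^ (1 / (d : ℝ)) = H * N := by
    rw [hX, natCast_pow_rpow_one_div hd0]; push_cast; rfl
  have hcount : ∀ I : Ideal (𝓞 L), Ideal.absNorm I ≠ 0 →
      (Ideal.absNorm I : ℝ) * boxCount c N I ≤
        W * (1 + D * (Ideal.absNorm I : ℝ) ^ (1 / (d : ℝ)) / N) ∧
      (Ideal.absNorm I : ℝ) * boxCount c N I ≤ W * B := by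
    intro I hI
    by_cases hIX : (Ideal.absNorm I : ℝ) ^ (1 / (d : ℝ)) ≤ H * N
    · have h1 := (hbox c N I hN hI).2 hIX
      refine ⟨h1, h1.trans (mul_le_mul_of_nonneg_left ?_ hW.le)⟩
      rw [hB, add_le_add_iff_left, div_le_iff₀ hN0, mul_assoc]
      exact mul_le_mul_of_nonneg_left hIX hD
    · have h0 : boxCount c N I = 0 := by
        rw [boxCount, Finset.card_eq_zero, Finset.filter_eq_empty_iff]
        intro β hβ hmem
        apply hIX
        have h1 := Nat.le_of_dvd (lt_of_lt_of_le (by positivity) (hc β hβ).1)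
          (map_dvd Ideal.absNorm (Ideal.dvd_span_singleton.mpr hmem))
        rw [← hXroot]
        exact Real.rpow_le_rpow (by positivity) (by exact_mod_cast h1.trans (hc β hβ).2)
          (by positivity)
      rw [h0]
      constructor
      · simp only [Nat.cast_zero, mul_zero]
        positivity
      · simp only [Nat.cast_zero, mul_zero]
        positivity
  have h1 : W * (d * Real.log N) ≤ ∑ P ∈ primeIdealsLE L X, Real.log (Ideal.absNorm P) *
      ∑ j ∈ Finset.Icc 1 X, (boxCount c N (P ^ j) : ℝ) := by
    have hswap : ∑ P ∈ primeIdealsLE L X, Real.log (Ideal.absNorm P) *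
        ∑ j ∈ Finset.Icc 1 X, (boxCount c N (P ^ j) : ℝ) =
        ∑ β ∈ coordBox L N, ∑ P ∈ primeIdealsLE L X, Real.log (Ideal.absNorm P) *
          ∑ j ∈ Finset.Icc 1 X, if c + β ∈ P ^ j then 1 else 0 := by
      rw [Finset.sum_comm]
      refine Finset.sum_congr rfl fun P _ => ?_
      rw [← Finset.mul_sum]
      congr 1
      simpa using sum_boxCount c N (Finset.Icc 1 X) (fun _ => 1) (fun j => P ^ j)
    rw [hswap, hWcard, ← nsmul_eq_mul, ← Finset.sum_const]
    refine Finset.sum_le_sum fun β hβ => ?_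
    obtain ⟨hl, hu⟩ := hc β hβ
    have hpos : 0 < Ideal.absNorm (Ideal.span {c + β}) := lt_of_lt_of_le (by positivity) hl
    have hne : c + β ≠ 0 := by
      rintro h0
      rw [h0] at hpos
      simp at hpos
    refine le_trans ?_ (log_absNorm_span_le hne hu (k := X) ?_)
    · rw [← Real.log_pow]
      exact Real.log_le_log (by positivity) (by exact_mod_cast hl)
    · exact lt_of_le_of_lt hu (Nat.lt_two_pow_self.trans (Nat.pow_lt_pow_right (by norm_num)
        (Nat.lt_succ_self _)))
  have hterm : ∀ P ∈ primeIdealsLE L X, Real.log (Ideal.absNorm P) *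
      ∑ j ∈ Finset.Icc 1 X, (boxCount c N (P ^ j) : ℝ) ≤
      (if (Ideal.absNorm P).Prime then W * (Real.log (Ideal.absNorm P) / Ideal.absNorm P +
        D / N * (Real.log (Ideal.absNorm P) * (Ideal.absNorm P : ℝ) ^ (1 / (d : ℝ) - 1))) else 0) +
      W * (2 * d * B) * (Real.log (Ideal.absNorm P).minFac /
        ((Ideal.absNorm P).minFac : ℝ) ^ 2) := by
    intro P hP
    obtain ⟨hPX, hPp⟩ := mem_primeIdealsLE.mp hP
    have hq2 := two_le_absNorm hPp
    set q := Ideal.absNorm P with hq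
    have hq0 : (0 : ℝ) < q := by positivity
    have hlog := Real.log_natCast_nonneg q
    have hcj : ∀ j, (boxCount c N (P ^ j) : ℝ) ≤ W * B * (((q ^ j : ℕ) : ℝ))⁻¹ := by
      intro j
      have h2 := (hcount (P ^ j) (by rw [map_pow, ← hq]; positivity)).2
      rw [map_pow, ← hq] at h2
      rw [← div_eq_mul_inv, le_div_iff₀ (by positivity), mul_comm]
      exact h2
    have hsum : ∀ m, ∑ j ∈ Finset.Ico m (X + 1), (boxCount c N (P ^ j) : ℝ) ≤
        W * B * (2 * ((q : ℝ) ^ m)⁻¹) := by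
      intro m
      refine (Finset.sum_le_sum fun j _ => hcj j).trans ?_
      rw [← Finset.mul_sum]
      exact mul_le_mul_of_nonneg_left (sum_Ico_inv_pow_le hq2 _ _) (by positivity)
    have hIcc : Finset.Icc 1 X = Finset.Ico 1 (X + 1) := by
      ext; simp
    rw [hIcc]
    by_cases hpr : q.Prime
    · rw [if_pos hpr, hpr.minFac_eq, Finset.sum_eq_sum_Ico_succ_bot (by omega), mul_add]
      refine add_le_add ?_ ?_
      · have h2 := (hcount P (by positivity)).1
        rw [← hq] at h2
        have h4 := mul_le_mul_of_nonneg_left h2 (div_nonneg hlog hq0.le)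
        rw [pow_one, Real.rpow_sub_one hq0.ne']
        convert h4 using 1
        · field_simp
        · field_simp
      · refine (mul_le_mul_of_nonneg_left (hsum 2) hlog).trans ?_
        have : Real.log q * (W * B * (2 * ((q : ℝ) ^ 2)⁻¹)) =
            W * (2 * 1 * B) * (Real.log q / (q : ℝ) ^ 2) := by field_simp
        rw [this]
        gcongr
    · rw [if_neg hpr, zero_add]
      refine (mul_le_mul_of_nonneg_left (hsum 1) hlog).trans ?_
      have hlogle := log_absNorm_le_finrank_mul hPp
      rw [← hq, ← hd] at hlogle
      obtain ⟨p, f, hp, hf, hpf, -⟩ := exists_absNorm_eq_pow hPp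
      rw [← hq] at hpf
      have hmf : q.minFac = p := by rw [hpf, Nat.pow_minFac (by omega), hp.minFac_eq]
      rw [hmf] at hlogle ⊢
      have hf2 : 2 ≤ f := by
        rcases Nat.lt_or_ge f 2 with h | h
        · obtain rfl : f = 1 := by omega
          rw [pow_one] at hpf
          exact absurd (hpf ▸ hp) hpr
        · exact h
      have hp2 : (p : ℝ) ^ 2 ≤ q := by
        rw [hpf]
        exact_mod_cast Nat.pow_le_pow_right hp.pos hf2
      have hp0 : (0 : ℝ) < p := by exact_mod_cast hp.pos
      have hlogp := Real.log_natCast_nonneg p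
      calc Real.log q * (W * B * (2 * ((q : ℝ) ^ 1)⁻¹))
          ≤ (d * Real.log p) * (W * B * (2 * ((p : ℝ) ^ 2)⁻¹)) := by
            rw [pow_one]
            gcongr
        _ = _ := by field_simp
  have h2 := h1.trans (Finset.sum_le_sum hterm)
  rw [Finset.sum_add_distrib, ← Finset.sum_filter, ← Finset.mul_sum, ← Finset.mul_sum,
    mul_assoc W, ← mul_add] at h2
  have h3 := le_of_mul_le_mul_left h2 hW
  rw [Finset.sum_add_distrib, ← Finset.mul_sum] at h3
  have h4 := hE X
  rw [hXroot] at h4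
  have h5 := mul_le_mul_of_nonneg_left h4 (div_nonneg hD hN0.le)
  have h6 : D / N * (d * (Real.log 4 * d * (H * N))) = D * (d * (Real.log 4 * d * H)) := by
    field_simp
  have h7 := sum_minFac_absNorm_le (L := L) (g := fun p => Real.log p / (p : ℝ) ^ 2)
    (fun p => div_nonneg (Real.log_natCast_nonneg p) (by positivity)) X
  have h8 := mul_le_mul_of_nonneg_left (h7.trans (mul_le_mul_of_nonneg_left
    (sum_primesLE_log_div_sq_le X) (by positivity))) (by positivity : 0 ≤ 2 * d * B)
  have h9 : ∑ P ∈ (primeIdealsLE L X).filter (fun P => (Ideal.absNorm P).Prime),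
      Real.log (Ideal.absNorm P) / Ideal.absNorm P = ∑ P ∈ degreeOneLE L X,
      Real.log (Ideal.absNorm P) / Ideal.absNorm P := by
    unfold degreeOneLE; congr!
  have h10 : ∑ P ∈ (primeIdealsLE L X).filter (fun P => (Ideal.absNorm P).Prime),
      Real.log (Ideal.absNorm P) * (Ideal.absNorm P : ℝ) ^ (1 / (d : ℝ) - 1) =
      ∑ P ∈ degreeOneLE L X,
      Real.log (Ideal.absNorm P) * (Ideal.absNorm P : ℝ) ^ (1 / (d : ℝ) - 1) := by
    unfold degreeOneLE; congr!
  rw [h9, h10] at h3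
  linarith

/-- A Chebyshev-type lower bound for the prime ideals of residue degree one. -/
theorem exists_pow_le_sum_log_degreeOneLE : ∃ C : ℕ, 1 ≤ C ∧ ∀ R : ℕ, 1 ≤ R →
    ((R ^ Module.finrank ℚ L : ℕ) : ℝ) ≤
      ∑ P ∈ degreeOneLE L (C * R ^ Module.finrank ℚ L), Real.log (Ideal.absNorm P) := by
  classical
  obtain ⟨C₁, h₁⟩ := exists_mertens_le L
  obtain ⟨H, hH, C₂, h₂⟩ := exists_le_mertens L
  set d := Module.finrank ℚ L with hd
  have hd0 : 0 < d := Module.finrank_pos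
  have hd1 : (1 : ℝ) ≤ d := by exact_mod_cast hd0
  obtain ⟨A, hA⟩ := exists_nat_ge (Real.exp (1 + |C₁| + |C₂|))
  have hA0 : (0 : ℝ) < A := (Real.exp_pos _).trans_le hA
  have hA1 : 1 ≤ A := by exact_mod_cast hA0
  have hlogA : 1 + |C₁| + |C₂| ≤ Real.log A := (Real.le_log_iff_exp_le hA0).mpr hA
  refine ⟨(H * A) ^ d, Nat.one_le_pow _ _ (by positivity), fun R hR => ?_⟩
  have hR0 : (0 : ℝ) < R := by exact_mod_cast hR
  have e₁ := h₁ R hR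
  have e₂ := h₂ (A * R) (Nat.mul_pos hA1 hR)
  rw [show (H * (A * R)) ^ d = (H * A) ^ d * R ^ d by rw [← mul_assoc, mul_pow]] at e₂
  set X := (H * A) ^ d * R ^ d with hX
  push_cast at e₂
  rw [Real.log_mul hA0.ne' hR0.ne'] at e₂
  have hsub : degreeOneLE L (R ^ d) ⊆ degreeOneLE L X := fun P hP => by
    rw [mem_degreeOneLE] at hP ⊢
    exact ⟨hP.1.trans (Nat.le_mul_of_pos_left _ (by positivity)), hP.2⟩
  have hdiff := Finset.sum_sdiff (f := fun P : Ideal (𝓞 L) =>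
    Real.log (Ideal.absNorm P) / Ideal.absNorm P) hsub
  have hone : 1 ≤ ∑ P ∈ degreeOneLE L X \ degreeOneLE L (R ^ d),
      Real.log (Ideal.absNorm P) / Ideal.absNorm P := by
    have h3 : Real.log A ≤ d * Real.log A := by nlinarith [abs_nonneg C₁, abs_nonneg C₂]
    have := le_abs_self C₁
    have := le_abs_self C₂
    nlinarith
  have hle : ∑ P ∈ degreeOneLE L X \ degreeOneLE L (R ^ d),
      Real.log (Ideal.absNorm P) / Ideal.absNorm P ≤
      (∑ P ∈ degreeOneLE L X, Real.log (Ideal.absNorm P)) / (R ^ d : ℕ) := by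
    rw [Finset.sum_div]
    refine (Finset.sum_le_sum fun P hP => ?_).trans (Finset.sum_le_sum_of_subset_of_nonneg
      Finset.sdiff_subset fun P _ _ => div_nonneg (Real.log_natCast_nonneg _) (by positivity))
    obtain ⟨hP1, hP2⟩ := Finset.mem_sdiff.mp hP
    rw [mem_degreeOneLE] at hP1 hP2
    have : R ^ d ≤ Ideal.absNorm P := by
      by_contra hlt
      exact hP2 ⟨by omega, hP1.2⟩
    have h4 : (0 : ℝ) < (R ^ d : ℕ) := by positivity
    exact div_le_div_of_nonneg_left (Real.log_natCast_nonneg _) h4 (by exact_mod_cast this)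
  have := hone.trans hle
  rwa [le_div_iff₀ (by positivity), one_mul] at this

theorem exists_degreeOne_notMem : ∃ C : ℕ, 1 ≤ C ∧ ∀ (a : 𝓞 L) (z : ℕ), a ≠ 0 → 1 ≤ z →
    Real.log (Ideal.absNorm (Ideal.span {a})) ≤ z →
    ∃ P : Ideal (𝓞 L), (Ideal.absNorm P).Prime ∧ Ideal.absNorm P ≤ C * z ∧ a ∉ P := by
  obtain ⟨C, hC, h⟩ := exists_pow_le_sum_log_degreeOneLE L
  set d := Module.finrank ℚ L with hd
  have hd0 : 0 < d := Module.finrank_pos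
  refine ⟨C * 2 ^ d, Nat.one_le_iff_ne_zero.mpr (by positivity), fun a z ha hz hlog => ?_⟩
  set s : ℝ := (z : ℝ) ^ (1 / (d : ℝ)) with hs
  have hz1 : (1 : ℝ) ≤ z := by exact_mod_cast hz
  have hs1 : 1 ≤ s := Real.one_le_rpow hz1 (by positivity)
  have hsd : s ^ d = z := by
    rw [hs, one_div, Real.rpow_inv_natCast_pow (by positivity) hd0.ne']
  set t := ⌊s⌋₊ with ht
  have h1 : s < t + 1 := Nat.lt_floor_add_one s
  have h2 : (t : ℝ) ≤ s := Nat.floor_le (by linarith)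
  have h3 : (z : ℝ) < ((t + 1) ^ d : ℕ) := by
    rw [← hsd]
    push_cast
    exact pow_lt_pow_left₀ h1 (by linarith) hd0.ne'
  have h4 : (t + 1) ^ d ≤ 2 ^ d * z := by
    have : ((t : ℝ) + 1) ^ d ≤ (2 * s) ^ d := by
      apply pow_le_pow_left₀ (by positivity)
      linarith
    rw [mul_pow, hsd] at this
    exact_mod_cast this
  have h5 := h (t + 1) (by omega)
  by_contra hcon
  push Not at hcon
  have h6 := sum_log_absNorm_le (S := degreeOneLE L (C * (t + 1) ^ d)) (a := a)
    (fun P hP => (mem_degreeOneLE.mp hP).2.1) ha fun P hP => by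
      obtain ⟨hP1, -, hP3⟩ := mem_degreeOneLE.mp hP
      refine hcon P hP3 (hP1.trans ?_)
      rw [mul_assoc]
      exact Nat.mul_le_mul_left C h4
  linarith

end Mertens

section Detection

theorem card_specialLinearGroup_zmod_le {m p : ℕ} (hm : 2 ≤ m) (hp : p.Prime) :
    Nat.card (Matrix.SpecialLinearGroup (Fin m) (ZMod p)) ≤ 2 * p ^ (m ^ 2 - 1) := by
  have : Fact p.Prime := ⟨hp⟩
  have : NeZero m := ⟨by omega⟩
  let F : Matrix.SpecialLinearGroup (Fin m) (ZMod p) × (ZMod p)ˣ → Matrix (Fin m) (Fin m) (ZMod p) :=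
    fun x => Matrix.updateRow x.1.1 0 ((x.2 : ZMod p) • x.1.1 0)
  have hF : Function.Injective F := by
    rintro ⟨g, u⟩ ⟨h, v⟩ hgh
    have hdet : ∀ x, (F x).det = x.2 := fun x => by
      simp [F, Matrix.det_updateRow_smul, x.1.2]
    have huv : u = v := Units.ext (by rw [← hdet (g, u), ← hdet (h, v), hgh])
    subst huv
    refine Prod.ext (Matrix.SpecialLinearGroup.ext _ _ fun i j => ?_) rfl
    have hij := congrFun (congrFun hgh i) j
    by_cases hi : i = 0
    · subst hi
      simpa [F] using hij
    · simpa [F, Matrix.updateRow_ne hi] using hij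
  have hM : Nat.card (Matrix (Fin m) (Fin m) (ZMod p)) = p ^ (m * m) := by
    simp [Matrix, pow_mul]
  have hcard := Nat.card_le_card_of_injective F hF
  rw [Nat.card_prod, Nat.card_eq_fintype_card (α := (ZMod p)ˣ), ZMod.card_units, hM] at hcard
  have hp2 := hp.two_le
  have hsq : p ^ (m * m) = p * p ^ (m ^ 2 - 1) := by
    rw [← pow_succ', sq, Nat.sub_add_cancel (Nat.mul_pos (by omega) (by omega))]
  rw [hsq] at hcard
  refine Nat.le_of_mul_le_mul_right (c := p - 1) (hcard.trans ?_) (by omega)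
  calc p * p ^ (m ^ 2 - 1) ≤ (2 * (p - 1)) * p ^ (m ^ 2 - 1) := Nat.mul_le_mul_right _ (by omega)
    _ = 2 * p ^ (m ^ 2 - 1) * (p - 1) := by ring

variable {L : Type*} [Field L] [NumberField L]

theorem exists_ringHom_zmod {P : Ideal (𝓞 L)} {p : ℕ} (hp : p.Prime) (hP : Ideal.absNorm P = p) :
    ∃ φ : 𝓞 L →+* ZMod p, ∀ a, φ a = 0 ↔ a ∈ P := by
  have hcard : Nat.card (𝓞 L ⧸ P) = p := by
    rw [← hP, Ideal.absNorm_apply, Submodule.cardQuot_apply]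
  have : Finite (𝓞 L ⧸ P) := Nat.finite_of_card_ne_zero (hcard ▸ hp.ne_zero)
  cases nonempty_fintype (𝓞 L ⧸ P)
  let e := ZMod.ringEquivOfPrime (𝓞 L ⧸ P) hp (Nat.card_eq_fintype_card.symm.trans hcard)
  refine ⟨(e.symm : 𝓞 L ⧸ P →+* ZMod p).comp (Ideal.Quotient.mk P), fun a => ?_⟩
  rw [RingHom.comp_apply, RingHom.coe_coe, map_eq_zero_iff _ e.symm.injective,
    Ideal.Quotient.eq_zero_iff_mem]

variable (L) in
theorem exists_log_absNorm_le : ∃ K : ℕ, ∀ (a : 𝓞 L) (A B l : ℕ), a ≠ 0 → 1 ≤ A → 1 ≤ B →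
    CoordLE (a : L) (B * A ^ l) →
    Real.log (Ideal.absNorm (Ideal.span {a})) ≤ Module.finrank ℚ L * (K + B + A * l) := by
  obtain ⟨K, hK, h⟩ := exists_norm_embedding_le L
  refine ⟨K, fun a A B l ha hA hB hab => ?_⟩
  have hle : ((Ideal.absNorm (Ideal.span {a}) : ℕ) : ℝ) ≤
      (K * (B * A ^ l)) ^ Module.finrank ℚ L := by
    rw [absNorm_span_eq_prod, ← AlgHom.card ℚ L ℂ, ← Finset.card_univ, ← Finset.prod_const]
    exact Finset.prod_le_prod (fun _ _ => norm_nonneg _) fun σ _ => h σ _ _ hab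
  have hpos : (0 : ℝ) < (Ideal.absNorm (Ideal.span {a}) : ℕ) := by
    have : Ideal.absNorm (Ideal.span {a}) ≠ 0 := by
      rw [Ne, Ideal.absNorm_eq_zero_iff, Ideal.span_singleton_eq_bot]
      exact ha
    exact_mod_cast Nat.pos_of_ne_zero this
  have hK0 : (K : ℝ) ≠ 0 := by positivity
  have hA0 : (A : ℝ) ≠ 0 := by positivity
  have hB0 : (B : ℝ) ≠ 0 := by positivity
  refine (Real.log_le_log hpos hle).trans ?_
  rw [Real.log_pow, Real.log_mul hK0 (by positivity), Real.log_mul hB0 (by positivity),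
    Real.log_pow]
  have hK' := Real.log_le_self (Nat.cast_nonneg (α := ℝ) K)
  have hA' := Real.log_le_self (Nat.cast_nonneg (α := ℝ) A)
  have hB' := Real.log_le_self (Nat.cast_nonneg (α := ℝ) B)
  have := mul_le_mul_of_nonneg_left hA' (Nat.cast_nonneg (α := ℝ) l)
  refine mul_le_mul_of_nonneg_left ?_ (Nat.cast_nonneg _)
  linarith

/-- Entries of products of integral matrices grow at most exponentially in the number of
factors. -/
theorem exists_coordLE_list_prod {m : ℕ} {ι : Type*} [Finite ι]
    (N : ι → Matrix (Fin m) (Fin m) (𝓞 L)) :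
    ∃ A B : ℕ, 1 ≤ A ∧ 1 ≤ B ∧ ∀ l : List ι, ∀ i j,
      CoordLE (((l.map N).prod i j : 𝓞 L) : L) (B * A ^ l.length) := by
  obtain ⟨C, hC, hmul⟩ := exists_coordLE_mul L
  obtain ⟨A, hA, hN⟩ := exists_coordLE_of_finite
    fun k : ι × Fin m × Fin m => ((N k.1 k.2.1 k.2.2 : 𝓞 L) : L)
  obtain ⟨B, hB, hone⟩ := exists_coordLE_of_finite
    fun k : Fin m × Fin m => (((1 : Matrix (Fin m) (Fin m) (𝓞 L)) k.1 k.2 : 𝓞 L) : L)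
  refine ⟨m * C * A + 1, B, by omega, hB, fun l => ?_⟩
  induction l with
  | nil => exact fun i j => by simpa using hone (i, j)
  | cons x l ih =>
    intro i j
    rw [List.map_cons, List.prod_cons, Matrix.mul_apply]
    have := CoordLE.sum Finset.univ fun k _ => hmul _ _ _ _ (hN (x, i, k)) (ih k j)
    have hsum : ((∑ k, N x i k * (l.map N).prod k j : 𝓞 L) : L) =
        ∑ k, (N x i k : L) * ((l.map N).prod k j : 𝓞 L) := by
      push_cast
      rfl
    rw [hsum]
    refine this.mono ?_
    rw [Finset.sum_const, Finset.card_univ, Fintype.card_fin, nsmul_eq_mul, List.length_cons]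
    push_cast
    have : (0 : ℝ) ≤ B * (m * C * A + 1) ^ l.length := by positivity
    rw [pow_succ]
    linarith

theorem exists_prime_detecting_list_prod {m : ℕ} {f : 𝓞 L} (hf : f ≠ 0)
    {S : Type*} [CommRing S] [Algebra (𝓞 L) S] [IsLocalization.Away f S]
    {T : Set (Matrix.SpecialLinearGroup (Fin m) S)} (hT : T.Finite) :
    ∃ C : ℕ, 1 ≤ C ∧ ∀ l : List (Matrix.SpecialLinearGroup (Fin m) S), (∀ x ∈ l, x ∈ T) →
      l.prod ≠ 1 → ∃ p : ℕ, p.Prime ∧ p ≤ C * l.length ∧ ∃ φ : S →+* ZMod p,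
        Matrix.SpecialLinearGroup.map φ l.prod ≠ 1 := by
  have := hT.to_subtype
  obtain ⟨⟨b, hb⟩, hint⟩ := IsLocalization.exist_integer_multiples_of_finite
    (Submonoid.powers f) fun k : T × Fin m × Fin m => k.1.1 k.2.1 k.2.2
  choose n hn using hint
  let N : T → Matrix (Fin m) (Fin m) (𝓞 L) := fun t i j => n (t, i, j)
  have hN : ∀ t : T, (N t).map (algebraMap (𝓞 L) S) = algebraMap (𝓞 L) S b • (t.1 : Matrix _ _ S) := by
    intro t
    ext i j
    rw [Matrix.map_apply, Matrix.smul_apply, smul_eq_mul, ← Algebra.smul_def]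
    exact hn (t, i, j)
  have hprod : ∀ l : List T, ((l.map N).prod).map (algebraMap (𝓞 L) S) =
      algebraMap (𝓞 L) S b ^ l.length •
        (((l.map Subtype.val).prod : Matrix.SpecialLinearGroup (Fin m) S) : Matrix _ _ S) := by
    intro l
    induction l with
    | nil => simp
    | cons x l ih =>
      rw [List.map_cons, List.prod_cons, Matrix.map_mul, ih, hN, List.map_cons, List.prod_cons,
        Matrix.SpecialLinearGroup.coe_mul, smul_mul_smul_comm, List.length_cons, pow_succ']
  let N' : Option T → Matrix (Fin m) (Fin m) (𝓞 L) := fun t => t.elim (b • 1) N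
  obtain ⟨A, B, hA, hB, hcoord⟩ := exists_coordLE_list_prod N'
  obtain ⟨C, hC, hmul⟩ := exists_coordLE_mul L
  obtain ⟨F, hF, hfF⟩ := exists_coordLE_of_finite fun _ : Unit => (f : L)
  obtain ⟨K, hlog⟩ := exists_log_absNorm_le L
  obtain ⟨D, hD, hprime⟩ := exists_degreeOne_notMem L
  set d := Module.finrank ℚ L
  have hd : 0 < d := Module.finrank_pos
  refine ⟨D * (d * (K + 2 * C * B * F + A)), Nat.one_le_iff_ne_zero.mpr (by positivity),
    fun l hl hne => ?_⟩
  obtain ⟨l, rfl⟩ : ∃ l' : List T, l'.map Subtype.val = l :=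
    ⟨l.attach.map fun x => ⟨x.1, hl x.1 x.2⟩, by simp⟩
  have hl1 : 1 ≤ l.length := by
    rcases l with _ | ⟨x, l⟩
    · simp at hne
    · simp
  obtain ⟨i, j, hij⟩ : ∃ i j, (l.map Subtype.val).prod i j ≠
      (1 : Matrix.SpecialLinearGroup (Fin m) S) i j := by
    by_contra! h
    exact hne (Matrix.SpecialLinearGroup.ext _ _ h)
  have h1 := hcoord (l.map some) i j
  have h2 := hcoord (List.replicate l.length none) i j
  have e1 : (l.map some).map N' = l.map N := by simp [N']
  have e2 : ((List.replicate l.length none).map N').prod = b ^ l.length • 1 := by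
    simp [N', smul_pow]
  rw [e1, List.length_map] at h1
  rw [e2, List.length_replicate] at h2
  set a : 𝓞 L := (l.map N).prod i j - (b ^ l.length • (1 : Matrix (Fin m) (Fin m) (𝓞 L))) i j with ha
  have haS : algebraMap (𝓞 L) S a = algebraMap (𝓞 L) S b ^ l.length *
      ((l.map Subtype.val).prod i j - (1 : Matrix.SpecialLinearGroup (Fin m) S) i j) := by
    have h3 := congrFun (congrFun (hprod l) i) j
    rw [Matrix.map_apply, Matrix.smul_apply, smul_eq_mul] at h3
    rw [ha, map_sub, h3, mul_sub, Matrix.smul_apply, smul_eq_mul, map_mul, map_pow]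
    congr 2
    rcases eq_or_ne i j with rfl | h
    · simp
    · simp [Matrix.one_apply_ne h]
  have hbu : IsUnit (algebraMap (𝓞 L) S b ^ l.length) :=
    (IsLocalization.map_units S (⟨b, hb⟩ : Submonoid.powers f)).pow _
  have ha0 : a ≠ 0 := by
    intro h0
    rw [h0, map_zero] at haS
    exact hij (sub_eq_zero.mp (hbu.mul_right_eq_zero.mp haS.symm))
  have hac : CoordLE ((a * f : 𝓞 L) : L) ((2 * C * B * F : ℕ) * (A : ℝ) ^ l.length) := by
    have := hmul _ _ _ _ (h1.sub h2) (hfF ())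
    rw [← map_sub, ← ha, ← map_mul] at this
    refine this.mono (le_of_eq ?_)
    push_cast
    ring
  have hbound := hlog (a * f) A (2 * C * B * F) l.length (mul_ne_zero ha0 hf) hA
    (Nat.one_le_iff_ne_zero.mpr (by positivity)) hac
  have hz : (d : ℝ) * (K + (2 * C * B * F : ℕ) + A * l.length) ≤
      ((d * (K + 2 * C * B * F + A) * l.length : ℕ) : ℝ) := by
    have : d * (K + 2 * C * B * F + A * l.length) ≤ d * (K + 2 * C * B * F + A) * l.length := by
      rw [mul_assoc d]
      refine Nat.mul_le_mul_left _ ?_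
      rw [add_mul]
      exact Nat.add_le_add_right (Nat.le_mul_of_pos_right _ hl1) _
    exact_mod_cast this
  obtain ⟨P, hPp, hPle, hPmem⟩ := hprime (a * f) (d * (K + 2 * C * B * F + A) * l.length)
    (mul_ne_zero ha0 hf) (Nat.one_le_iff_ne_zero.mpr (by positivity)) (hbound.trans hz)
  have : Fact (Ideal.absNorm P).Prime := ⟨hPp⟩
  obtain ⟨ψ, hψ⟩ := exists_ringHom_zmod hPp rfl
  have hψf : IsUnit (ψ f) :=
    isUnit_iff_ne_zero.mpr fun h => hPmem (P.mul_mem_left a ((hψ f).mp h))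
  refine ⟨_, hPp, by rwa [List.length_map, mul_assoc], IsLocalization.Away.lift f hψf, fun h => ?_⟩
  have h4 : IsLocalization.Away.lift f hψf ((l.map Subtype.val).prod i j) =
      IsLocalization.Away.lift f hψf ((1 : Matrix.SpecialLinearGroup (Fin m) S) i j) := by
    have h5 := congrArg (fun g : Matrix.SpecialLinearGroup (Fin m) (ZMod (Ideal.absNorm P)) =>
      g i j) (h.trans (map_one (Matrix.SpecialLinearGroup.map
        (IsLocalization.Away.lift (S := S) f hψf))).symm)
    simpa only [Matrix.SpecialLinearGroup.map_apply_coe, RingHom.mapMatrix_apply,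
      Matrix.map_apply] using h5
  have h3 := congrArg (IsLocalization.Away.lift f hψf) haS
  rw [IsLocalization.Away.lift_eq, map_mul, map_sub (IsLocalization.Away.lift (S := S) f hψf), h4, sub_self, mul_zero, hψ] at h3
  exact hPmem (P.mul_mem_right f h3)

end Detection

section FarbGrowth

variable {G : Type*} [Group G]

theorem exists_list_length_eq_wordLength {Y : Set G} (hY : Subgroup.closure Y = ⊤) (g : G) :
    ∃ l : List G, l.length = wordLength Y g ∧ (∀ x ∈ l, x ∈ Y ∨ x⁻¹ ∈ Y) ∧ l.prod = g := by
  have hg : g ∈ (Subgroup.closure Y).toSubmonoid := hY ▸ Subgroup.mem_top g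
  rw [Subgroup.closure_toSubmonoid] at hg
  obtain ⟨l, hl, hprod⟩ := Submonoid.exists_list_of_mem_closure hg
  exact Nat.sInf_mem (s := {n | ∃ l : List G, l.length = n ∧
    (∀ x ∈ l, x ∈ Y ∨ x⁻¹ ∈ Y) ∧ l.prod = g}) ⟨l.length, l, rfl, hl, hprod⟩

theorem farbD_le_card {H : Type*} [Group H] [Finite H] (φ : G →* H) {g : G} (hg : φ g ≠ 1) :
    farbD g ≤ Nat.card H := by
  have hle : farbD g ≤ φ.ker.index :=
    Nat.sInf_le ⟨φ.ker, inferInstance, inferInstance, by rwa [MonoidHom.mem_ker], rfl⟩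
  refine hle.trans ?_
  rw [Subgroup.index_ker]
  exact Nat.card_le_card_of_injective _ Subtype.val_injective

theorem farbF_le {Y : Set G} {n b : ℕ} (h : ∀ g : G, g ≠ 1 → wordLength Y g ≤ n → farbD g ≤ b) :
    farbF Y n ≤ b := by
  refine csSup_le' ?_
  rintro d ⟨g, hg, hgn, rfl⟩
  exact h g hg hgn

variable {L : Type*} [Field L] [NumberField L]

theorem exists_prime_detecting_of_generators {m : ℕ} {f : 𝓞 L} (hf : f ≠ 0)
    {S : Type*} [CommRing S] [Algebra (𝓞 L) S] [IsLocalization.Away f S]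
    {Γ : Subgroup (Matrix.SpecialLinearGroup (Fin m) S)} {Y : Set Γ} (hYfin : Y.Finite)
    (hY : Subgroup.closure Y = ⊤) :
    ∃ C : ℕ, 1 ≤ C ∧ ∀ γ : Γ, γ ≠ 1 → ∃ p : ℕ, p.Prime ∧ p ≤ C * wordLength Y γ ∧
      ∃ φ : Γ →* Matrix.SpecialLinearGroup (Fin m) (ZMod p), φ γ ≠ 1 := by
  obtain ⟨C, hC, h⟩ := exists_prime_detecting_list_prod hf (S := S)
    ((hYfin.union hYfin.inv).image Γ.subtype)
  refine ⟨C, hC, fun γ hγ => ?_⟩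
  obtain ⟨l, hlen, hl, rfl⟩ := exists_list_length_eq_wordLength hY γ
  obtain ⟨p, hp, hle, φ, hφ⟩ := h (l.map Γ.subtype)
    (fun x hx => by
      obtain ⟨y, hy, rfl⟩ := List.mem_map.mp hx
      exact ⟨y, hl y hy, rfl⟩)
    (fun h1 => hγ (Γ.subtype_injective (by rw [map_list_prod, h1, map_one])))
  refine ⟨p, hp, by rwa [List.length_map, hlen] at hle,
    (Matrix.SpecialLinearGroup.map φ).comp Γ.subtype, ?_⟩
  rwa [MonoidHom.comp_apply, map_list_prod]

end FarbGrowth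

/-- Proposition 4.2: a finitely generated subgroup `Γ` of
`SL_m(𝓞_{L,f})` is residually finite with normal Farb growth `≼ n^{m²−1}`,
and the detecting quotients can be taken of the form `SL_m(𝔽_p)`. -/
theorem farb_growth_upper_bound_SL_ring_of_S_integers
    (m : ℕ) (hm : 2 ≤ m) (L : Type*) [Field L] [NumberField L]
    (f : ℤ) (hf : f ≠ 0)
    (Γ : Subgroup (Matrix.SpecialLinearGroup (Fin m)
        (Localization.Away ((f : 𝓞 L)))))
    (hfg : Group.FG Γ) :
    ResiduallyFinite Γ ∧
      ∀ Y : Finset Γ, Subgroup.closure (Y : Set Γ) = ⊤ →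
        FarbPreceq (farbF (Y : Set Γ)) (fun n => n ^ (m ^ 2 - 1)) ∧
        ∃ M : ℕ, 0 < M ∧
          ∀ γ : Γ, γ ≠ 1 → ∀ n : ℕ, wordLength (Y : Set Γ) γ ≤ n →
            ∃ p : ℕ, p.Prime ∧
              ∃ φ : Γ →* Matrix.SpecialLinearGroup (Fin m) (ZMod p),
                φ γ ≠ 1 ∧
                Nat.card (Matrix.SpecialLinearGroup (Fin m) (ZMod p)) ≤
                  M * (M * n) ^ (m ^ 2 - 1) := by
  have hf' : (f : 𝓞 L) ≠ 0 := Int.cast_ne_zero.mpr hf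
  constructor
  · obtain ⟨Y, hY⟩ := Group.fg_iff.mp hfg
    obtain ⟨C, -, h⟩ := exists_prime_detecting_of_generators hf' hY.2 hY.1
    intro γ hγ
    obtain ⟨p, hp, -, φ, hφ⟩ := h γ hγ
    have : NeZero p := ⟨hp.ne_zero⟩
    exact ⟨φ.ker, inferInstance, inferInstance, by rwa [MonoidHom.mem_ker]⟩
  · intro Y hY
    obtain ⟨C, hC, h⟩ := exists_prime_detecting_of_generators hf' Y.finite_toSet hY
    have key : ∀ γ : Γ, γ ≠ 1 → ∀ n : ℕ, wordLength (Y : Set Γ) γ ≤ n →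
        ∃ p : ℕ, p.Prime ∧ ∃ φ : Γ →* Matrix.SpecialLinearGroup (Fin m) (ZMod p), φ γ ≠ 1 ∧
          Nat.card (Matrix.SpecialLinearGroup (Fin m) (ZMod p)) ≤
            2 * C * (2 * C * n) ^ (m ^ 2 - 1) := by
      intro γ hγ n hn
      obtain ⟨p, hp, hle, φ, hφ⟩ := h γ hγ
      refine ⟨p, hp, φ, hφ, (card_specialLinearGroup_zmod_le hm hp).trans ?_⟩
      have hpn : p ≤ 2 * C * n := hle.trans
        (Nat.mul_le_mul (Nat.le_mul_of_pos_left C two_pos) hn)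
      exact Nat.mul_le_mul (Nat.le_mul_of_pos_right 2 hC) (Nat.pow_le_pow_left hpn _)
    have hpos : 0 < 2 * C := by omega
    refine ⟨⟨2 * C, hpos, fun n => farbF_le fun γ hγ hn => ?_⟩, 2 * C, hpos, key⟩
    obtain ⟨p, hp, φ, hφ, hcard⟩ := key γ hγ n hn
    have : NeZero p := ⟨hp.ne_zero⟩
    exact (farbD_le_card φ hφ).trans hcard
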